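/- arXiv:2106.11651 — 3 statements merged into one kernel-verified Lean document; each statement's English description precedes it below -/
import Mathlib

section
/- Let Γ be a finite group acting by automorphisms on a group G. Suppose there is an exact sequence 1 → K → G → ℤ^r → 1, where K is a finite normal subgroup of G and r is a non-negative integer (so G/K is free abelian of rank r). Then the nonabelian cohomology set H¹(Γ, G) is finite. -/
/-- A (nonabelian) 1-cocycle of a group `Γ` acting on a group `G` by automorphisms:
`c (σ * τ) = c σ * σ • c τ`. -/
def IsMulCocycle {Γ G : Type*} [Group Γ] [Group G] [MulDistribMulAction Γ G]
    (c : Γ → G) : Prop :=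
  ∀ σ τ : Γ, c (σ * τ) = c σ * σ • c τ

/-- Nonabelian first cohomology set `H¹(Γ, G)`: 1-cocycles modulo the relation
`c ~ c'` iff there is `g : G` with `c' σ = g⁻¹ * c σ * σ • g` for all `σ`. -/
def MulH1 (Γ G : Type*) [Group Γ] [Group G] [MulDistribMulAction Γ G] : Type _ :=
  Quot (fun c c' : {c : Γ → G // IsMulCocycle c} =>
    ∃ g : G, ∀ σ : Γ, c'.val σ = g⁻¹ * c.val σ * σ • g)

namespace Subgroup

variable {G : Type*} [Group G]

/-- The subgroup of `k`-th powers of elements of a commutative subgroup. -/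
def powers (Z : Subgroup G) [IsMulCommutative Z] (k : ℕ) : Subgroup G where
  carrier := {x | ∃ z ∈ Z, z ^ k = x}
  one_mem' := ⟨1, Z.one_mem, one_pow k⟩
  mul_mem' := by
    rintro _ _ ⟨x, hx, rfl⟩ ⟨y, hy, rfl⟩
    have hxy : Commute x y := setLike_mul_comm hx hy
    exact ⟨x * y, Z.mul_mem hx hy, hxy.mul_pow k⟩
  inv_mem' := by
    rintro _ ⟨x, hx, rfl⟩
    exact ⟨x⁻¹, Z.inv_mem hx, inv_pow x k⟩

theorem mem_powers {Z : Subgroup G} [IsMulCommutative Z] {k : ℕ} {x : G} :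
    x ∈ Z.powers k ↔ ∃ z ∈ Z, z ^ k = x := Iff.rfl

theorem powers_le (Z : Subgroup G) [IsMulCommutative Z] (k : ℕ) : Z.powers k ≤ Z := by
  rintro _ ⟨z, hz, rfl⟩
  exact Z.pow_mem hz k

instance characteristic_powers (Z : Subgroup G) [IsMulCommutative Z] [hZ : Z.Characteristic]
    (k : ℕ) : (Z.powers k).Characteristic := by
  refine characteristic_iff_le_comap.mpr fun φ x hx => ?_
  obtain ⟨z, hz, rfl⟩ := hx
  exact ⟨φ z, characteristic_iff_le_comap.mp hZ φ hz, (map_pow φ z k).symm⟩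

instance isMulCommutative_powers (Z : Subgroup G) [IsMulCommutative Z] (k : ℕ) :
    IsMulCommutative (Z.powers k) :=
  .of_setLike_mul_comm fun _ ha _ hb =>
    setLike_mul_comm (Z.powers_le k ha) (Z.powers_le k hb)

theorem smul_mem_of_characteristic {Γ : Type*} [Group Γ] [MulDistribMulAction Γ G]
    (A : Subgroup G) [hA : A.Characteristic] (σ : Γ) {a : G} (ha : a ∈ A) : σ • a ∈ A :=
  characteristic_iff_le_comap.mp hA (MulDistribMulAction.toMulEquiv G σ) ha

/-- A finite normal subgroup is centralized by a common power of all elements. -/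
theorem exists_pow_mem_centralizer (K : Subgroup G) [K.Normal] [Finite K] :
    ∃ e ≠ 0, ∀ g : G, g ^ e ∈ centralizer (K : Set G) := by
  have : Finite (MulAut K) := Finite.of_injective (fun φ : MulAut K => (φ : K → K))
    DFunLike.coe_injective
  refine ⟨Nat.card (MulAut K), Nat.card_pos.ne', fun g k hk => ?_⟩
  have h : MulAut.conjNormal (H := K) (g ^ Nat.card (MulAut K)) = 1 := by
    rw [map_pow, pow_card_eq_one']
  have h' := congrArg Subtype.val (DFunLike.congr_fun h ⟨k, hk⟩)
  rw [MulAut.conjNormal_apply] at h'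
  exact (mul_inv_eq_iff_eq_mul.mp h').symm

/-- If `K` is finite with abelian quotient, then `|K|`-th powers of elements centralizing `K`
commute with everything centralizing `K`. -/
theorem commute_pow_card_of_mem_centralizer {A : Type*} [CommGroup A] (f : G →* A) {x y : G}
    (hx : x ∈ centralizer (f.ker : Set G)) : Commute (x ^ Nat.card f.ker) y := by
  have hz : x⁻¹ * (y⁻¹ * x * y) ∈ f.ker := by simp [MonoidHom.mem_ker, mul_comm]
  have hc : Commute x (x⁻¹ * (y⁻¹ * x * y)) := (hx _ hz).symm
  have h1 : (x⁻¹ * (y⁻¹ * x * y)) ^ Nat.card f.ker = 1 :=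
    congrArg Subtype.val (pow_card_eq_one' (x := (⟨_, hz⟩ : f.ker)))
  have h2 : (y⁻¹ * x * y) ^ Nat.card f.ker = x ^ Nat.card f.ker := by
    have := hc.mul_pow (Nat.card f.ker)
    rwa [h1, mul_one, mul_inv_cancel_left] at this
  have h3 := conj_pow (i := Nat.card f.ker) (a := y⁻¹) (b := x)
  rw [inv_inv, h2] at h3
  rw [commute_iff_eq, ← mul_right_inj y⁻¹, inv_mul_cancel_left, ← mul_assoc]
  exact h3.symm

theorem finiteIndex_of_forall_pow_mem {A : Type*} [CommGroup A] [Group.FG A] (f : G →* A)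
    (hf : Function.Surjective f) [Finite f.ker] (N : Subgroup G) [N.Normal] {M : ℕ} (hM : M ≠ 0)
    (h : ∀ g : G, g ^ M ∈ N) : N.FiniteIndex := by
  have hfin : Finite (A ⧸ N.map f) := by
    refine CommGroup.finite_of_fg_isMulTorsion _ fun x => ?_
    obtain ⟨a, rfl⟩ := QuotientGroup.mk_surjective x
    obtain ⟨g, rfl⟩ := hf a
    refine isOfFinOrder_iff_pow_eq_one.mpr ⟨M, Nat.pos_of_ne_zero hM, ?_⟩
    rw [← QuotientGroup.mk_pow, QuotientGroup.eq_one_iff, ← map_pow]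
    exact mem_map_of_mem f (h g)
  have hsup : (N ⊔ f.ker).index ≠ 0 := by
    rw [← comap_map_eq, index_comap_of_surjective _ hf]
    exact index_ne_zero_of_finite
  rw [finiteIndex_iff, ← relIndex_mul_index (le_sup_left : N ≤ N ⊔ f.ker), relIndex_sup_left]
  exact mul_ne_zero index_ne_zero_of_finite hsup

theorem characteristic_ker_of_isMulTorsionFree {A : Type*} [Group A] [IsMulTorsionFree A]
    (f : G →* A) [Finite f.ker] : f.ker.Characteristic := by
  refine characteristic_iff_le_comap.mpr fun φ x hx => ?_
  have h1 : x ^ Nat.card f.ker = 1 :=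
    congrArg Subtype.val (pow_card_eq_one' (x := (⟨x, hx⟩ : f.ker)))
  refine (pow_eq_one_iff_left (Nat.card_pos (α := f.ker)).ne').mp ?_
  change f (φ x) ^ _ = 1
  rw [← map_pow, ← map_pow, h1, map_one, map_one]

/-- A finite-by-(finitely generated torsion-free abelian) group has a torsion-free commutative
characteristic subgroup whose subgroups of powers have finite index. -/
theorem exists_characteristic_torsionFree_finiteIndex_powers {A : Type*} [CommGroup A]
    [Group.FG A] [IsMulTorsionFree A] (f : G →* A) (hf : Function.Surjective f) [Finite f.ker] :
    ∃ (B : Subgroup G) (_ : IsMulCommutative B), B.Characteristic ∧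
      (∀ n ≠ 0, ∀ x ∈ B, x ^ n = 1 → x = 1) ∧ ∀ n ≠ 0, (B.powers n).FiniteIndex := by
  have := characteristic_ker_of_isMulTorsionFree f
  set m := Nat.card f.ker with hm
  have hm0 : m ≠ 0 := Nat.card_pos.ne'
  set C := centralizer (f.ker : Set G)
  let Z := C ⊓ centralizer (C : Set G)
  have hZ : IsMulCommutative Z := .of_setLike_mul_comm fun _ ha _ hb => hb.2 _ ha.1
  refine ⟨Z.powers m, inferInstance, inferInstance, ?_, fun n hn => ?_⟩
  · rintro n hn _ ⟨z, -, rfl⟩ hz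
    have hzK : z ∈ f.ker := by
      refine (pow_eq_one_iff_left (mul_ne_zero hm0 hn)).mp ?_
      rw [← map_pow, pow_mul, hz, map_one]
    exact congrArg Subtype.val (pow_card_eq_one' (x := (⟨z, hzK⟩ : f.ker)))
  · obtain ⟨e, he, hC⟩ := exists_pow_mem_centralizer f.ker
    refine finiteIndex_of_forall_pow_mem f hf _
      (mul_ne_zero (mul_ne_zero he hm0) (mul_ne_zero hm0 hn)) fun g => ?_
    rw [pow_mul, pow_mul, pow_mul]
    exact ⟨_, ⟨_, ⟨C.pow_mem (hC g) m,
      fun y _ => (commute_pow_card_of_mem_centralizer f (hC g)).symm.eq⟩, rfl⟩, rfl⟩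

end Subgroup

open scoped IsMulCommutative in
/-- Cocycles that agree up to `|Γ|`-th powers from a torsion-free commutative characteristic
subgroup are cohomologous. -/
theorem IsMulCocycle.cohomologous_of_mem_powers {Γ G : Type*} [Group Γ] [Finite Γ] [Group G]
    [MulDistribMulAction Γ G] (A : Subgroup G) [IsMulCommutative A] [A.Characteristic]
    (htf : ∀ x ∈ A, x ^ Nat.card Γ = 1 → x = 1) {c c' : Γ → G} (hc : IsMulCocycle c)
    (hc' : IsMulCocycle c') (h : ∀ σ, c' σ / c σ ∈ A.powers (Nat.card Γ)) :
    ∃ g : G, ∀ σ : Γ, c' σ = g⁻¹ * c σ * σ • g := by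
  have := Fintype.ofFinite Γ
  choose b hbA hb using h
  let φ (σ : Γ) : A →* A :=
    (((MulAut.conj (c σ)).toMonoidHom.comp
      (MulDistribMulAction.toMonoidHom G σ)).comp A.subtype).codRestrict A fun a =>
        Subgroup.Normal.conj_mem inferInstance _ (A.smul_mem_of_characteristic σ a.2) (c σ)
  have hφ (σ : Γ) (a : A) : (φ σ a : G) = c σ * σ • (a : G) * (c σ)⁻¹ := rfl
  let β (σ : Γ) : A := ⟨b σ, hbA σ⟩
  have hβ (σ : Γ) : c' σ = (β σ : G) ^ Nat.card Γ * c σ := by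
    rw [hb σ, div_mul_cancel]
  have hβc (σ τ : Γ) : β (σ * τ) = β σ * φ σ (β τ) := by
    refine div_eq_one.mp (Subtype.ext (htf _ (SetLike.coe_mem _) ?_))
    rw [← Subgroup.coe_pow, div_pow, OneMemClass.coe_eq_one, div_eq_one, mul_pow, ← map_pow]
    ext
    have h1 := hc' σ τ
    rw [hβ, hβ σ, hβ τ, hc, ← eq_mul_inv_iff_mul_eq] at h1
    simp only [Subgroup.coe_mul, Subgroup.coe_pow, hφ, h1, smul_mul', smul_pow']
    group
  let B : A := ∏ τ, β τ
  have hB (σ : Γ) : B = β σ ^ Nat.card Γ * φ σ B := by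
    calc B = ∏ τ, β (σ * τ) := (Equiv.prod_comp (Equiv.mulLeft σ) β).symm
      _ = _ := by simp [hβc, Finset.prod_mul_distrib, B, map_prod]
  refine ⟨(B : G)⁻¹, fun σ => ?_⟩
  have h2 := congrArg (Subtype.val) (hB σ)
  rw [Subgroup.coe_mul, hφ, Subgroup.coe_pow] at h2
  rw [inv_inv, smul_inv', hβ]
  nth_rewrite 1 [h2]
  group

/-- If `Γ` is a finite group acting on a group `G` by automorphisms, and there is an
exact sequence `1 → K → G → ℤ^r → 1` with `K` a finite (normal) subgroup of `G`
(expressed as: `K` is the kernel of a surjective homomorphism `G →* ℤ^r`), then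
the nonabelian cohomology set `H¹(Γ, G)` is finite. -/
theorem finite_mulH1_of_finite_by_free_abelian {Γ G : Type*} [Group Γ] [Finite Γ]
    [Group G] [MulDistribMulAction Γ G]
    (r : ℕ) (K : Subgroup G) (hKfin : Finite K)
    (f : G →* Multiplicative (Fin r → ℤ))
    (hf : Function.Surjective f) (hker : f.ker = K) :
    Finite (MulH1 Γ G) := by
  subst hker
  obtain ⟨A, _, _, htf, hfi⟩ := Subgroup.exists_characteristic_torsionFree_finiteIndex_powers f hf
  have hn : Nat.card Γ ≠ 0 := Nat.card_pos.ne'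
  have := hfi _ hn
  let F (c : {c : Γ → G // IsMulCocycle c}) (σ : Γ) : G ⧸ A.powers (Nat.card Γ) := c.val σ
  have hF (c c') (h : F c = F c') : (Quot.mk _ c : MulH1 Γ G) = Quot.mk _ c' := by
    refine Quot.sound (c.2.cohomologous_of_mem_powers A (htf _ hn) c'.2 fun σ => ?_)
    rw [← QuotientGroup.eq_iff_div_mem]
    exact (congrFun h σ).symm
  refine Finite.of_injective (fun x : MulH1 Γ G => F x.out) fun x y h => ?_
  rw [← Quot.out_eq x, ← Quot.out_eq y]
  exact hF _ _ h
end

section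
/- Let Γ be a finite group acting by automorphisms on a group G. If G is an almost abelian group of finite rank r, then the nonabelian cohomology set H¹(Γ, G) is finite. -/
/-- `G` is an almost abelian group of finite rank `r`: there is a normal subgroup `G⁰`
of `G` of finite index together with a finite normal subgroup `K` of `G⁰` and an exact
sequence `1 → K → G⁰ → ℤ^r → 1` (expressed as: `K` is the kernel of a surjective
homomorphism `G⁰ →* ℤ^r`). -/
def IsAlmostAbelianOfRank (G : Type*) [Group G] (r : ℕ) : Prop :=
  ∃ G0 : Subgroup G, G0.Normal ∧ G0.FiniteIndex ∧
    ∃ (K : Subgroup G0) (f : G0 →* Multiplicative (Fin r → ℤ)),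
      Finite K ∧ Function.Surjective f ∧ f.ker = K

/-- An extension of a finitely generated group by a finitely generated group is finitely
generated. -/
theorem Group.fg_of_surjective_of_fg_ker {G H : Type*} [Group G] [Group H] (f : G →* H)
    (hf : Function.Surjective f) [Group.FG H] [Group.FG f.ker] : Group.FG G := by
  obtain ⟨S, hS⟩ := (Group.fg_def (G := H)).1 ‹_›
  obtain ⟨T, hT⟩ := (Group.fg_iff_subgroup_fg f.ker).1 ‹_›
  refine Group.fg_iff.2 ⟨Function.surjInv hf '' S ∪ T, ?_,
    (S.finite_toSet.image _).union T.finite_toSet⟩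
  have hker : f.ker ≤ Subgroup.closure (Function.surjInv hf '' S ∪ T) := by
    rw [← hT]
    exact Subgroup.closure_mono Set.subset_union_right
  have hmap : (Subgroup.closure (Function.surjInv hf '' S ∪ T)).map f = ⊤ := by
    rw [eq_top_iff, ← hS, Subgroup.closure_le]
    intro s hs
    exact ⟨_, Subgroup.subset_closure (Or.inl ⟨s, hs, rfl⟩), Function.surjInv_eq hf s⟩
  rw [← Subgroup.comap_map_eq_self hker, hmap, Subgroup.comap_top]

/-- In a finitely generated commutative group, the subgroup of `n`-th powers has finite index. -/
theorem finiteIndex_range_powMonoidHom (A : Type*) [CommGroup A] [Group.FG A] {n : ℕ}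
    (hn : 0 < n) : (powMonoidHom n : A →* A).range.FiniteIndex := by
  have : Finite (A ⧸ (powMonoidHom n : A →* A).range) := by
    refine CommGroup.finite_of_fg_isMulTorsion _ fun x => ?_
    induction x using QuotientGroup.induction_on with
    | H a =>
      refine isOfFinOrder_iff_pow_eq_one.2 ⟨n, hn, ?_⟩
      rw [← QuotientGroup.mk_pow, QuotientGroup.eq_one_iff]
      exact ⟨a, rfl⟩
  exact Subgroup.finiteIndex_of_finite_quotient

/-- An almost abelian group of finite rank is finitely generated. -/
theorem IsAlmostAbelianOfRank.fg {G : Type*} [Group G] {r : ℕ}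
    (h : IsAlmostAbelianOfRank G r) : Group.FG G := by
  obtain ⟨G0, _, _, K, f, hK, hf, rfl⟩ := h
  have : Group.FG (Multiplicative (Fin r → ℤ)) := inferInstance
  have : Group.FG G0 := Group.fg_of_surjective_of_fg_ker f hf
  have : Group.FG (QuotientGroup.mk' G0).ker := by rwa [QuotientGroup.ker_mk']
  exact Group.fg_of_surjective_of_fg_ker _ (QuotientGroup.mk'_surjective G0)

/-- An almost abelian group of finite rank has a torsion-free commutative subgroup of finite
index. -/
theorem IsAlmostAbelianOfRank.exists_commutative_torsionFree {G : Type*} [Group G] {r : ℕ}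
    (h : IsAlmostAbelianOfRank G r) :
    ∃ B : Subgroup G, B.FiniteIndex ∧ (∀ a ∈ B, ∀ b ∈ B, a * b = b * a) ∧
      ∀ a ∈ B, ∀ n : ℕ, 0 < n → a ^ n = 1 → a = 1 := by
  have hfg := h.fg
  obtain ⟨G0, _, _, K, f, hK, hf, rfl⟩ := h
  have : Group.FG G0 := inferInstance
  have : Finite (commutatorSet G0) := by
    refine (Set.Finite.subset (s := (f.ker : Set G0)) (Set.toFinite _) ?_).to_subtype
    rintro _ ⟨a, b, rfl⟩
    simp [MonoidHom.mem_ker, commutatorElement_def]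
  let Z := Subgroup.center G0
  let _ : CommGroup Z :=
    { (inferInstance : Group Z) with
      mul_comm := fun a b => Subtype.ext (Subgroup.mem_center_iff.1 b.2 a) }
  have : Z.FiniteIndex := inferInstance
  have hm : 0 < Nat.card f.ker := Nat.card_pos
  let P := (powMonoidHom (Nat.card f.ker) : Z →* Z).range
  have hP : P.FiniteIndex := finiteIndex_range_powMonoidHom Z hm
  refine ⟨(P.map Z.subtype).map G0.subtype, ⟨?_⟩, ?_, ?_⟩
  · rw [Subgroup.index_map_subtype, Subgroup.index_map_subtype]
    exact mul_ne_zero (mul_ne_zero hP.index_ne_zero Subgroup.FiniteIndex.index_ne_zero)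
      Subgroup.FiniteIndex.index_ne_zero
  · rintro _ ⟨_, ⟨x, -, rfl⟩, rfl⟩ _ ⟨_, ⟨y, -, rfl⟩, rfl⟩
    simp only [← map_mul, mul_comm x y]
  · rintro _ ⟨_, ⟨_, ⟨z, rfl⟩, rfl⟩, rfl⟩ n hn hz
    have hz' : (z : G0) ^ (Nat.card f.ker * n) = 1 := by
      apply G0.subtype_injective
      simpa [pow_mul] using hz
    have hzK : (z : G0) ∈ f.ker := by
      rw [MonoidHom.mem_ker]
      have h1 : f z ^ (Nat.card f.ker * n) = 1 := by rw [← map_pow, hz', map_one]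
      have h2 : (Nat.card f.ker * n) • (f z).toAdd = 0 := by
        rw [← toAdd_pow, h1, toAdd_one]
      exact (smul_eq_zero.1 h2).resolve_left (mul_pos hm hn).ne'
    have h3 : (⟨z, hzK⟩ : f.ker) ^ Nat.card f.ker = 1 := pow_card_eq_one'
    have h4 : (z : G0) ^ Nat.card f.ker = 1 := congrArg Subtype.val h3
    simpa using congrArg G0.subtype h4

/-- Every finite index subgroup `B` of a group with an action of a finite group `Γ` contains a
normal `Γ`-stable subgroup of finite index. -/
theorem exists_normal_smul_stable_le {Γ G : Type*} [Group Γ] [Finite Γ] [Group G]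
    [MulDistribMulAction Γ G] (B : Subgroup G) [B.FiniteIndex] :
    ∃ A ≤ B, A.Normal ∧ A.FiniteIndex ∧ ∀ (σ : Γ), ∀ a ∈ A, σ • a ∈ A := by
  refine ⟨⨅ σ : Γ, B.normalCore.comap (MulDistribMulAction.toMonoidHom G σ), ?_, ?_, ?_, ?_⟩
  · refine (iInf_le _ 1).trans fun x hx => B.normalCore_le ?_
    simpa using hx
  · exact Subgroup.normal_iInf_normal fun σ => inferInstance
  · refine Subgroup.finiteIndex_iInf fun σ => ⟨?_⟩
    rw [Subgroup.index_comap_of_surjective _ (MulAction.surjective σ)]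
    exact Subgroup.FiniteIndex.index_ne_zero
  · intro σ a ha
    simp only [Subgroup.mem_iInf, Subgroup.mem_comap, MulDistribMulAction.toMonoidHom_apply]
      at ha ⊢
    intro τ
    rw [← mul_smul]
    exact ha _

/-- Two twisted cocycles with values in a commutative group without `|Γ|`-torsion are cohomologous
as soon as the products of their values differ by a `|Γ|`-th power. -/
theorem cohomologous_of_prod_eq_mul_pow {Γ A : Type*} [Group Γ] [Fintype Γ] [CommGroup A]
    (htf : ∀ a : A, a ^ Fintype.card Γ = 1 → a = 1) (θ : Γ → A →* A) {d e : Γ → A}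
    (hd : ∀ σ τ, d (σ * τ) = d σ * θ σ (d τ)) (he : ∀ σ τ, e (σ * τ) = e σ * θ σ (e τ))
    (t : A) (ht : ∏ τ, d τ = (∏ τ, e τ) * t ^ Fintype.card Γ) (σ : Γ) :
    d σ * θ σ t = e σ * t := by
  have key : ∀ {c : Γ → A}, (∀ σ τ, c (σ * τ) = c σ * θ σ (c τ)) →
      ∏ τ, c τ = c σ ^ Fintype.card Γ * θ σ (∏ τ, c τ) := by
    intro c hc
    calc ∏ τ, c τ = ∏ τ, c (σ * τ) := (Equiv.prod_comp (Equiv.mulLeft σ) c).symm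
      _ = _ := by simp [hc, Finset.prod_mul_distrib]
  have h1 := key hd
  have h2 := key he
  rw [ht, map_mul, map_pow] at h1
  rw [← div_eq_one]
  apply htf
  rw [div_pow, div_eq_one, mul_pow, mul_pow]
  apply mul_right_cancel (b := θ σ (∏ τ, e τ))
  calc _ = (∏ τ, e τ) * t ^ Fintype.card Γ := by
        rw [h1]
        exact mul_right_comm _ _ _ |>.trans (mul_assoc _ _ _)
    _ = _ := by
      conv_lhs => rw [h2]
      exact mul_right_comm _ _ _

/-- If `Γ` is a finite group acting by automorphisms on a group `G` that is almost
abelian of finite rank `r`, then the nonabelian cohomology set `H¹(Γ, G)` is finite. -/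
theorem finite_mulH1_of_almostAbelian {Γ G : Type*} [Group Γ] [Finite Γ]
    [Group G] [MulDistribMulAction Γ G]
    (r : ℕ) (h : IsAlmostAbelianOfRank G r) :
    Finite (MulH1 Γ G) := by
  have := Fintype.ofFinite Γ
  have hfg := h.fg
  obtain ⟨B, _, hBcomm, hBtf⟩ := h.exists_commutative_torsionFree
  obtain ⟨A, hAB, hAn, _, hAΓ⟩ := exists_normal_smul_stable_le (Γ := Γ) B
  let _ : CommGroup A :=
    { (inferInstance : Group A) with
      mul_comm := fun a b => Subtype.ext (hBcomm a (hAB a.2) b (hAB b.2)) }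
  have : Group.FG A := Subgroup.fg_of_index_ne_zero A
  have htf : ∀ a : A, a ^ Fintype.card Γ = 1 → a = 1 := fun a ha =>
    Subtype.ext (hBtf a (hAB a.2) _ Fintype.card_pos (congrArg Subtype.val ha))
  let P := (powMonoidHom (Fintype.card Γ) : A →* A).range
  have : P.FiniteIndex := finiteIndex_range_powMonoidHom A Fintype.card_pos
  let p : {c : Γ → G // IsMulCocycle c} → Γ → G ⧸ A := fun c σ => c.1 σ
  let s : {c : Γ → G // IsMulCocycle c} → {c : Γ → G // IsMulCocycle c} := fun c =>
    Set.rangeSplitting p (Set.rangeFactorization p c)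
  have hs : ∀ c, p (s c) = p c := fun c => Set.apply_rangeSplitting p _
  have hmem : ∀ c σ, c.1 σ * ((s c).1 σ)⁻¹ ∈ A := fun c σ => by
    rw [← QuotientGroup.eq_one_iff, QuotientGroup.mk_mul, QuotientGroup.mk_inv, mul_inv_eq_one]
    exact (congrFun (hs c) σ).symm
  let d : {c : Γ → G // IsMulCocycle c} → Γ → A := fun c σ => ⟨_, hmem c σ⟩
  let θ : {c : Γ → G // IsMulCocycle c} → Γ → A →* A := fun c σ =>
    { toFun := fun a => ⟨c.1 σ * σ • (a : G) * (c.1 σ)⁻¹, hAn.conj_mem _ (hAΓ σ a a.2) _⟩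
      map_one' := by ext; simp
      map_mul' := fun a b => by ext; simp [smul_mul', mul_assoc] }
  have hd : ∀ c σ τ, d c (σ * τ) = d c σ * θ (s c) σ (d c τ) := fun c σ τ => by
    ext
    simp [d, θ, c.2 σ τ, (s c).2 σ τ, mul_assoc]
  let I : {c : Γ → G // IsMulCocycle c} → (Γ → G ⧸ A) × (A ⧸ P) := fun c =>
    (p c, ((∏ τ, d c τ : A) : A ⧸ P))
  have hI : ∀ c c', I c = I c' → (Quot.mk _ c : MulH1 Γ G) = Quot.mk _ c' := by
    intro c c' hcc
    obtain ⟨h1, h2⟩ := Prod.ext_iff.1 hcc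
    have hss : s c = s c' := congrArg (Set.rangeSplitting p) (Subtype.ext h1)
    obtain ⟨t, ht⟩ := QuotientGroup.eq.1 h2.symm
    refine Quot.sound ⟨t, fun σ => ?_⟩
    have hσ := cohomologous_of_prod_eq_mul_pow htf (θ (s c)) (hd c)
      (by rw [hss]; exact hd c') t (by rw [← powMonoidHom_apply, ht, mul_inv_cancel_left]) σ
    rw [mul_comm (d c' σ)] at hσ
    have hσ' := congrArg Subtype.val hσ
    simp only [d, θ, ← hss, MonoidHom.coe_mk, OneHom.coe_mk, Subgroup.coe_mul] at hσ'
    rw [mul_assoc, eq_inv_mul_iff_mul_eq]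
    apply mul_right_cancel (b := ((s c).1 σ)⁻¹)
    rw [mul_assoc, ← hσ']
    group
  refine Finite.of_injective (fun q : MulH1 Γ G => I q.out) fun q q' hq => ?_
  rw [← Quot.out_eq q, ← Quot.out_eq q']
  exact hI _ _ hq
end

section
/- Let Λ be a free ℤ-module of finite rank n equipped with a ℤ-valued symmetric bilinear form whose extension B to V = Λ ⊗ ℝ is nondegenerate of signature (1, n−1). Let 𝒞 be one of the two connected components of {x ∈ V : B(x,x) > 0} and let 𝒞̄ be its closure. Let Π ⊆ 𝒞̄ be the convex cone generated by finitely many elements of 𝒞̄ ∩ Λ (a rational polyhedral cone contained in the closed positive cone). Then for every fixed positive integer d, the set {x ∈ Π ∩ Λ : B(x,x) = d} is finite. -/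
/-- Two vectors of the closed forward cone of Lorentzian space pair nonnegatively. -/
theorem lorentzian_pairing_nonneg {ι : Type*} [Fintype ι] {s t : ℝ} {p q : ι → ℝ}
    (hp : ∑ i, p i * p i ≤ s * s) (hq : ∑ i, q i * q i ≤ t * t) (hst : 0 ≤ s * t) :
    0 ≤ s * t - ∑ i, p i * q i := by
  have hcs := Finset.sum_mul_sq_le_sq_mul_sq Finset.univ p q
  simp only [pow_two (p _), pow_two (q _)] at hcs
  have hq0 : 0 ≤ ∑ i, q i * q i := Finset.sum_nonneg fun i _ => mul_self_nonneg _
  have h := mul_le_mul hp hq hq0 (mul_self_nonneg s)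
  have : ∑ i, p i * q i ≤ s * t := le_of_sq_le_sq (by nlinarith) hst
  linarith

/-- A vector of nonnegative norm orthogonal to a timelike vector of Lorentzian space is zero. -/
theorem lorentzian_eq_zero_of_orthogonal {ι : Type*} [Fintype ι] {s t : ℝ} {p q : ι → ℝ}
    (hp : ∑ i, p i * p i < s * s) (hq : ∑ i, q i * q i ≤ t * t)
    (h : s * t - ∑ i, p i * q i = 0) : t = 0 ∧ q = 0 := by
  have hcs := Finset.sum_mul_sq_le_sq_mul_sq Finset.univ p q
  simp only [pow_two (p _), pow_two (q _)] at hcs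
  have hp0 : 0 ≤ ∑ i, p i * p i := Finset.sum_nonneg fun i _ => mul_self_nonneg _
  have h1 := mul_le_mul_of_nonneg_left hq hp0
  have ht : t = 0 := by
    by_contra ht
    have : 0 < (s * s - ∑ i, p i * p i) * (t * t) :=
      mul_pos (by linarith) (mul_self_pos.2 ht)
    rw [← sub_eq_zero.1 h] at hcs
    nlinarith
  subst ht
  refine ⟨rfl, funext fun i => ?_⟩
  have h2 := Finset.single_le_sum (f := fun i => q i * q i)
    (fun i _ => mul_self_nonneg _) (Finset.mem_univ i)
  have h3 : q i * q i ≤ 0 := by simpa using h2.trans hq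
  exact mul_self_eq_zero.1 (le_antisymm h3 (mul_self_nonneg _))

/-- On a preconnected set, a continuous nowhere vanishing real function has constant sign. -/
theorem IsPreconnected.mul_pos_of_ne_zero {X : Type*} [TopologicalSpace X] {S : Set X}
    (hS : IsPreconnected S) {f : X → ℝ} (hf : ContinuousOn f S) (h0 : ∀ x ∈ S, f x ≠ 0)
    {x y : X} (hx : x ∈ S) (hy : y ∈ S) : 0 < f x * f y := by
  by_contra! hneg
  have hord := (hS.image f hf).ordConnected
  have hmem : (0 : ℝ) ∈ f '' S := by
    rcases mul_nonpos_iff.1 hneg with ⟨h1, h2⟩ | ⟨h1, h2⟩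
    · exact hord.out ⟨y, hy, rfl⟩ ⟨x, hx, rfl⟩ ⟨h2, h1⟩
    · exact hord.out ⟨x, hx, rfl⟩ ⟨y, hy, rfl⟩ ⟨h1, h2⟩
  obtain ⟨z, hz, hz0⟩ := hmem
  exact h0 z hz hz0

/-- Only finitely many integer vectors have all coordinates bounded by given constants. -/
theorem finite_integer_vectors_of_abs_le {ι : Type*} [Finite ι] (M : ι → ℝ) :
    {x : ι → ℝ | (∃ z : ι → ℤ, (fun i => (z i : ℝ)) = x) ∧ ∀ i, |x i| ≤ M i}.Finite := by
  classical
  have := Fintype.ofFinite ι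
  refine ((Set.finite_Icc (fun i => -⌈M i⌉) (fun i => ⌈M i⌉)).image
    (fun (z : ι → ℤ) i => (z i : ℝ))).subset ?_
  rintro _ ⟨⟨z, rfl⟩, hz⟩
  refine ⟨z, ⟨fun i => ?_, fun i => ?_⟩, rfl⟩
  · have h1 := (abs_le.1 (hz i)).1
    have h2 := Int.le_ceil (M i)
    have : ((-⌈M i⌉ : ℤ) : ℝ) ≤ z i := by push_cast; linarith
    exact_mod_cast this
  · have : (z i : ℝ) ≤ ⌈M i⌉ := (abs_le.1 (hz i)).2.trans (Int.le_ceil (M i))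
    exact_mod_cast this


/-- Let `Λ = ℤⁿ ⊂ V = ℝⁿ` (a free `ℤ`-module of rank `n` with `V = Λ ⊗ ℝ`), and let `B`
be a symmetric bilinear form on `V` taking integer values on `Λ`, nondegenerate of
signature `(1, n − 1)` (i.e. `V` splits as an orthogonal sum of a positive definite line
and a negative definite complement of dimension `n - 1`). Let `C` be one of the two
connected components of `{x | B(x,x) > 0}` and `C̄` its closure. If `P ⊆ C̄` is the
convex cone generated by finitely many elements of `C̄ ∩ Λ`, then for every positive
integer `d` the set of `x ∈ P ∩ Λ` with `B(x,x) = d` is finite. -/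
theorem finite_lattice_points_of_degree_in_rational_polyhedral_cone
    (n : ℕ) (hn : 1 ≤ n)
    (B : LinearMap.BilinForm ℝ (Fin n → ℝ))
    (hsymm : ∀ x y, B x y = B y x)
    (hint : ∀ x y : Fin n → ℤ,
      ∃ m : ℤ, B (fun i => (x i : ℝ)) (fun i => (y i : ℝ)) = (m : ℝ))
    (hsig : ∃ e : (Fin n → ℝ) ≃ₗ[ℝ] ℝ × (Fin (n - 1) → ℝ),
      ∀ x y, B x y = (e x).1 * (e y).1 - ∑ i, (e x).2 i * (e y).2 i)
    (Λ : Set (Fin n → ℝ))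
    (hΛ : Λ = Set.range (fun (x : Fin n → ℤ) => fun i => (x i : ℝ)))
    (C : Set (Fin n → ℝ))
    (hC : ∃ x₀ ∈ {x : Fin n → ℝ | 0 < B x x},
      C = connectedComponentIn {x : Fin n → ℝ | 0 < B x x} x₀)
    (P : Set (Fin n → ℝ))
    (hP : P ⊆ closure C ∧
      ∃ (m : ℕ) (v : Fin m → (Fin n → ℝ)),
        (∀ j, v j ∈ closure C ∩ Λ) ∧
        P = {x | ∃ a : Fin m → ℝ, (∀ j, 0 ≤ a j) ∧ x = ∑ j, a j • v j})
    (d : ℤ) (hd : 0 < d) :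
    Set.Finite {x ∈ P ∩ Λ | B x x = (d : ℝ)} := by
  obtain ⟨e, he⟩ := hsig
  obtain ⟨x₀, hx₀, rfl⟩ := hC
  obtain ⟨hPC, m, v, hv, rfl⟩ := hP
  subst hΛ
  have he1 : Continuous fun x => (e x).1 :=
    continuous_fst.comp e.toLinearMap.continuous_of_finiteDimensional
  have he2 : Continuous fun x => (e x).2 :=
    continuous_snd.comp e.toLinearMap.continuous_of_finiteDimensional
  have hBc : Continuous fun x => B x x := by
    simp only [he]
    exact (he1.mul he1).sub (continuous_finsetSum _ fun i _ =>
      ((continuous_apply i).comp he2).mul ((continuous_apply i).comp he2))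
  have hne : ∀ x, 0 < B x x → (e x).1 ≠ 0 := by
    intro x hx h0
    rw [he, h0] at hx
    have := Finset.sum_nonneg fun i (_ : i ∈ Finset.univ) => mul_self_nonneg ((e x).2 i)
    linarith
  have hcl : ∀ x ∈ closure (connectedComponentIn {x | 0 < B x x} x₀),
      0 ≤ B x x ∧ 0 ≤ (e x).1 * (e x₀).1 := by
    intro x hx
    refine closure_minimal (t := {x | 0 ≤ B x x ∧ 0 ≤ (e x).1 * (e x₀).1}) (fun y hy => ?_)
      ((isClosed_le continuous_const hBc).inter
        (isClosed_le continuous_const (he1.mul continuous_const))) hx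
    have hsub := connectedComponentIn_subset {x | 0 < B x x} x₀
    exact ⟨(hsub hy).le, (isPreconnected_connectedComponentIn.mul_pos_of_ne_zero
      he1.continuousOn (fun z hz => hne z (hsub hz)) hy
      (mem_connectedComponentIn hx₀)).le⟩
  refine (finite_integer_vectors_of_abs_le fun i => ∑ j, (d : ℝ) * |v j i|).subset ?_
  rintro x ⟨⟨hxP, hxΛ⟩, hxd⟩
  refine ⟨hxΛ, fun i => ?_⟩
  have hxC := hcl x (hPC hxP)
  obtain ⟨a, ha, hxa⟩ := hxP
  have hd' : (0 : ℝ) < d := by exact_mod_cast hd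
  have hnonneg : ∀ j, 0 ≤ B x (v j) := by
    intro j
    have hvC := hcl _ (hv j).1
    rw [he] at hxC hvC ⊢
    refine lorentzian_pairing_nonneg (by linarith [hxC.1]) (by linarith [hvC.1]) ?_
    have h := mul_nonneg hxC.2 hvC.2
    have hpos := mul_self_pos.2 (hne x₀ hx₀)
    refine nonneg_of_mul_nonneg_left ?_ hpos
    linarith
  have hsum : ∑ j, a j * B x (v j) = d := by
    rw [← hxd]
    conv_rhs => rw [show B x x = B x (∑ j, a j • v j) from congrArg (B x) hxa]
    simp
  have hbound : ∀ j, a j * |v j i| ≤ d * |v j i| := by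
    intro j
    by_cases hvj : v j = 0
    · simp [hvj]
    refine mul_le_mul_of_nonneg_right ?_ (abs_nonneg _)
    have hBne : B x (v j) ≠ 0 := by
      intro h0
      have hvC := hcl _ (hv j).1
      rw [he] at h0 hvC hxd
      obtain ⟨h1, h2⟩ := lorentzian_eq_zero_of_orthogonal (by linarith) (by linarith [hvC.1]) h0
      exact hvj (e.map_eq_zero_iff.1 (Prod.ext h1 h2))
    have hone : 1 ≤ B x (v j) := by
      have hpos := (hnonneg j).lt_of_ne' hBne
      obtain ⟨z, rfl⟩ := hxΛ
      obtain ⟨w, hw⟩ := (hv j).2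
      obtain ⟨k, hk⟩ := hint z w
      rw [← hw] at hpos ⊢
      simp only [hk] at hpos ⊢
      exact_mod_cast hpos
    calc a j ≤ a j * B x (v j) := le_mul_of_one_le_right (ha j) hone
      _ ≤ ∑ j, a j * B x (v j) := Finset.single_le_sum
        (f := fun j => a j * B x (v j)) (fun j _ => mul_nonneg (ha j) (hnonneg j))
        (Finset.mem_univ j)
      _ = d := hsum
  calc |x i| = |∑ j, a j * v j i| := by rw [hxa]; simp
    _ ≤ ∑ j, |a j * v j i| := Finset.abs_sum_le_sum_abs _ _
    _ ≤ ∑ j, (d : ℝ) * |v j i| := Finset.sum_le_sum fun j _ => by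
      rw [abs_mul, abs_of_nonneg (ha j)]
      exact hbound j
end
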